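/- Let (K_r) be a family of fields indexed by 𝕀 with nonprincipal ultrafilter 𝒰, let K = ∏_𝒰 K_r, and consider the natural embedding of the polynomial ring K[Z_i : i < ω] into the internal polynomial ring ∏_𝒰 (K_r[Z_i : i < ω]). Then the internal polynomial ring is a flat module over K[Z_i : i < ω]. -/

import Mathlib

open Filter

variable {ι : Type} (𝒰 : Ultrafilter ι)

/-- The setoid identifying `ι`-indexed families agreeing almost everywhere w.r.t. `𝒰`. -/
def upSetoid (R : ι → Type) : Setoid (∀ i, R i) where
  r a b := ∀ᶠ i in (𝒰 : Filter ι), a i = b i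
  iseqv := ⟨fun _ => Eventually.of_forall fun _ => rfl,
    fun h => h.mono fun _ e => e.symm,
    fun h1 h2 => h2.mp (h1.mono fun _ e1 e2 => e1.trans e2)⟩

/-- The ultraproduct `∏_𝒰 R i`. -/
def UProd (R : ι → Type) : Type := Quotient (upSetoid 𝒰 R)

/-- The class of the family `a` in the ultraproduct. -/
def UProd.mk {R : ι → Type} (a : ∀ i, R i) : UProd 𝒰 R := Quotient.mk (upSetoid 𝒰 R) a

variable (R : ι → Type) [∀ i, CommRing (R i)]

instance : Zero (UProd 𝒰 R) := ⟨UProd.mk 𝒰 fun _ => 0⟩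
instance : One (UProd 𝒰 R) := ⟨UProd.mk 𝒰 fun _ => 1⟩

instance : Add (UProd 𝒰 R) :=
  ⟨Quotient.map₂ (fun a b i => a i + b i) (by
    intro a a' ha b b' hb
    exact (ha.and hb).mono fun i ⟨h1, h2⟩ => by simp only [h1, h2])⟩

instance : Mul (UProd 𝒰 R) :=
  ⟨Quotient.map₂ (fun a b i => a i * b i) (by
    intro a a' ha b b' hb
    exact (ha.and hb).mono fun i ⟨h1, h2⟩ => by simp only [h1, h2])⟩

instance : Neg (UProd 𝒰 R) :=
  ⟨Quotient.map (fun a i => - a i) (by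
    intro a a' ha
    exact ha.mono fun i h1 => by simp only [h1])⟩

/-- The ultraproduct of commutative rings is a commutative ring (coordinatewise a.e.). -/
instance instCommRingUProd : CommRing (UProd 𝒰 R) where
  add := (· + ·)
  mul := (· * ·)
  neg := (- ·)
  zero := 0
  one := 1
  add_assoc := by
    rintro ⟨a⟩ ⟨b⟩ ⟨c⟩
    exact Quotient.sound (Eventually.of_forall fun i => add_assoc _ _ _)
  zero_add := by
    rintro ⟨a⟩
    exact Quotient.sound (Eventually.of_forall fun i => zero_add _)
  add_zero := by
    rintro ⟨a⟩
    exact Quotient.sound (Eventually.of_forall fun i => add_zero _)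
  add_comm := by
    rintro ⟨a⟩ ⟨b⟩
    exact Quotient.sound (Eventually.of_forall fun i => add_comm _ _)
  mul_assoc := by
    rintro ⟨a⟩ ⟨b⟩ ⟨c⟩
    exact Quotient.sound (Eventually.of_forall fun i => mul_assoc _ _ _)
  one_mul := by
    rintro ⟨a⟩
    exact Quotient.sound (Eventually.of_forall fun i => one_mul _)
  mul_one := by
    rintro ⟨a⟩
    exact Quotient.sound (Eventually.of_forall fun i => mul_one _)
  zero_mul := by
    rintro ⟨a⟩
    exact Quotient.sound (Eventually.of_forall fun i => zero_mul _)
  mul_zero := by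
    rintro ⟨a⟩
    exact Quotient.sound (Eventually.of_forall fun i => mul_zero _)
  left_distrib := by
    rintro ⟨a⟩ ⟨b⟩ ⟨c⟩
    exact Quotient.sound (Eventually.of_forall fun i => left_distrib _ _ _)
  right_distrib := by
    rintro ⟨a⟩ ⟨b⟩ ⟨c⟩
    exact Quotient.sound (Eventually.of_forall fun i => right_distrib _ _ _)
  mul_comm := by
    rintro ⟨a⟩ ⟨b⟩
    exact Quotient.sound (Eventually.of_forall fun i => mul_comm _ _)
  neg_add_cancel := by
    rintro ⟨a⟩
    exact Quotient.sound (Eventually.of_forall fun i => neg_add_cancel _)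
  nsmul := nsmulRec
  zsmul := zsmulRec

/-- The internal subset of the ultraproduct with components `A i`: an element belongs to it
iff its coordinates belong to the components almost everywhere. -/
def internalSet (A : ∀ i, Set (R i)) : Set (UProd 𝒰 R) :=
  {x | Quotient.liftOn x (fun a => ∀ᶠ i in (𝒰 : Filter ι), a i ∈ A i)
    (fun a b hab => propext
      ⟨fun h => (hab.and h).mono fun _ ⟨e, hi⟩ => e ▸ hi,
       fun h => (hab.and h).mono fun _ ⟨e, hi⟩ => e ▸ hi⟩)}

variable (K : ι → Type) [∀ i, Field (K i)]

/-- The coordinatewise constants map from the ultraproduct field `K = ∏_𝒰 K i` into the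
internal polynomial ring `∏_𝒰 K i[Z]`. -/
noncomputable def constHom : UProd 𝒰 K →+* UProd 𝒰 (fun i => MvPolynomial ℕ (K i)) where
  toFun := Quotient.map (fun a i => MvPolynomial.C (a i))
    (fun a b hab => hab.mono fun i e => by simp only [e])
  map_one' := Quotient.sound (Eventually.of_forall fun i => by simp)
  map_zero' := Quotient.sound (Eventually.of_forall fun i => by simp)
  map_mul' := by
    rintro ⟨a⟩ ⟨b⟩
    exact Quotient.sound (Eventually.of_forall fun i => by simp)
  map_add' := by
    rintro ⟨a⟩ ⟨b⟩
    exact Quotient.sound (Eventually.of_forall fun i => by simp)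

/-- The natural embedding of the polynomial ring `K[Z_i : i < ω]` over the ultraproduct
field `K = ∏_𝒰 K i` into the internal polynomial ring `∏_𝒰 K i[Z_j : j < ω]`, obtained by
unpacking the coefficients coordinatewise (it sends constants to coordinatewise constants
and each variable `Z_j` to the corresponding internal variable). -/
noncomputable def upPolyEmb :
    MvPolynomial ℕ (UProd 𝒰 K) →+* UProd 𝒰 (fun i => MvPolynomial ℕ (K i)) :=
  MvPolynomial.eval₂Hom (constHom 𝒰 K) (fun j => UProd.mk 𝒰 fun _ => MvPolynomial.X j)


namespace MonomialOrder

open MvPolynomial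

section LeadingTerm

variable {σ k : Type*} [CommRing k] (m : MonomialOrder σ)

/-- `g` has leading exponent `d` and leading coefficient `1`. -/
def HasMonicLead (g : MvPolynomial σ k) (d : σ →₀ ℕ) : Prop :=
  (∀ e ∈ g.support, m.toSyn e ≤ m.toSyn d) ∧ g.coeff d = 1

/-- The polynomials all of whose exponents, shifted by `d`, lie strictly below `N`. -/
noncomputable def shiftedBelow (k : Type*) [CommRing k] (d : σ →₀ ℕ) (N : m.syn) :
    Submodule k (MvPolynomial σ k) :=
  restrictSupport k {e | m.toSyn (e + d) < N}

variable {m}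

theorem mem_shiftedBelow {d : σ →₀ ℕ} {N : m.syn} {p : MvPolynomial σ k} :
    p ∈ m.shiftedBelow k d N ↔ ∀ e ∈ p.support, m.toSyn (e + d) < N :=
  Iff.rfl

theorem shiftedBelow_mono {d : σ →₀ ℕ} {N N' : m.syn} (h : N ≤ N') :
    m.shiftedBelow k d N ≤ m.shiftedBelow k d N' :=
  fun _ hp _ he => (hp he).trans_le h

theorem monomial_mul_mem_shiftedBelow {d e E : σ →₀ ℕ} (c : k) {p : MvPolynomial σ k}
    (hp : p ∈ m.shiftedBelow k d (m.toSyn e)) (he : e ≤ E) :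
    monomial (E - e) c * p ∈ m.shiftedBelow k d (m.toSyn E) := by
  classical
  intro u hu
  obtain ⟨v, hv, w, hw, rfl⟩ := Finset.mem_add.mp (support_mul _ _ hu)
  have hv' : v = E - e := by
    have := support_monomial_subset hv
    simpa using this
  subst hv'
  have h1 : m.toSyn (w + d) < m.toSyn e := hp hw
  show m.toSyn (E - e + w + d) < m.toSyn E
  conv_rhs => rw [← tsub_add_cancel_of_le he]
  rw [add_assoc, map_add, map_add m.toSyn (E - e) e]
  exact add_lt_add_right h1 _

theorem HasMonicLead.degree_le {g : MvPolynomial σ k} {d : σ →₀ ℕ} (hg : m.HasMonicLead g d) :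
    m.toSyn (m.degree g) ≤ m.toSyn d :=
  m.degree_le_iff.mpr hg.1

theorem HasMonicLead.coeff_mul {g p : MvPolynomial σ k} {d E : σ →₀ ℕ} (hg : m.HasMonicLead g d)
    (hp : ∀ e ∈ p.support, m.toSyn (e + d) ≤ m.toSyn E) [Decidable (d ≤ E)] :
    (p * g).coeff E = if d ≤ E then p.coeff (E - d) else 0 := by
  classical
  split_ifs with h
  · have hp' : m.toSyn (m.degree p) ≤ m.toSyn (E - d) := by
      refine m.degree_le_iff.mpr fun e he => ?_
      have := hp e he
      rw [← tsub_add_cancel_of_le h, map_add, map_add] at this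
      exact le_of_add_le_add_right this
    have := m.coeff_mul_of_add_of_degree_le hp' hg.degree_le
    rwa [tsub_add_cancel_of_le h, hg.2, mul_one] at this
  · by_contra hne
    obtain ⟨u, hu, v, hv, huv⟩ := Finset.mem_add.mp (support_mul _ _ (mem_support_iff.mpr hne))
    have h1 := hp u hu
    rw [← huv, map_add, map_add, add_le_add_iff_left] at h1
    have : v = d := m.toSyn.injective (le_antisymm (hg.1 v hv) h1)
    exact h (by rw [← huv, this]; exact le_add_self)

theorem HasMonicLead.sub_monomial_mul_mem {g p : MvPolynomial σ k} {d E : σ →₀ ℕ}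
    (hg : m.HasMonicLead g d) (hp : m.toSyn (m.degree p) ≤ m.toSyn E) (hd : d ≤ E) :
    p - monomial (E - d) (p.coeff E) * g ∈ m.shiftedBelow k 0 (m.toSyn E) := by
  classical
  refine mem_shiftedBelow.mpr fun u hu => ?_
  have hmon : m.toSyn (m.degree (monomial (E - d) (p.coeff E))) ≤ m.toSyn (E - d) :=
    m.degree_monomial_le _
  have hle : m.toSyn u ≤ m.toSyn E := by
    refine (m.le_degree hu).trans (m.degree_sub_le.trans (sup_le hp ?_))
    refine m.degree_mul_le.trans ?_
    conv_rhs => rw [← tsub_add_cancel_of_le hd]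
    rw [map_add, map_add]
    exact add_le_add hmon hg.degree_le
  have hne : u ≠ E := by
    rintro rfl
    have h1 := m.coeff_mul_of_add_of_degree_le hmon hg.degree_le
    rw [tsub_add_cancel_of_le hd, hg.2, mul_one, coeff_monomial, if_pos rfl] at h1
    exact mem_support_iff.mp hu (by rw [coeff_sub, h1, sub_self])
  rw [add_zero]
  exact lt_of_le_of_ne hle fun h => hne (m.toSyn.injective h)

end LeadingTerm

section Syzygies

variable {σ k κ : Type*} [CommRing k] [DecidableEq κ] (m : MonomialOrder σ)

/-- The vector of coefficients expressing that the S-polynomial of two polynomials with leading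
exponents `d i` and `d j` is the combination with coefficients `q`. -/
noncomputable def sSyzygy (d : κ → σ →₀ ℕ) (i j : κ) (q : κ → MvPolynomial σ k) :
    κ → MvPolynomial σ k :=
  Pi.single i (monomial (d i ⊔ d j - d i) 1) - Pi.single j (monomial (d i ⊔ d j - d j) 1) - q

variable {m}

/-- **Schreyer's theorem**: if all S-polynomials of a family of monic polynomials have standard
representations, then the corresponding syzygies span all syzygies of the family. -/
theorem mem_span_sSyzygy [Fintype κ] {g : κ → MvPolynomial σ k} {d : κ → σ →₀ ℕ}
    {q : κ → κ → κ → MvPolynomial σ k} (hg : ∀ j, m.HasMonicLead (g j) (d j))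
    (hq : ∀ i j l, q i j l ∈ m.shiftedBelow k (d l) (m.toSyn (d i ⊔ d j)))
    (hS : ∀ i j, ∑ l, sSyzygy d i j (q i j) l * g l = 0)
    (x : κ → MvPolynomial σ k) (hx : ∑ l, x l * g l = 0) :
    x ∈ Submodule.span (MvPolynomial σ k)
      (Set.range fun ij : κ × κ => sSyzygy d ij.1 ij.2 (q ij.1 ij.2)) := by
  classical
  set W := Submodule.span (MvPolynomial σ k)
      (Set.range fun ij : κ × κ => sSyzygy d ij.1 ij.2 (q ij.1 ij.2))
  let F : (κ → MvPolynomial σ k) → Finset m.syn := fun x =>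
    Finset.univ.biUnion fun l => (x l).support.image fun e => m.toSyn (e + d l)
  induction hM : (F x).max using WellFoundedLT.induction generalizing x with
  | ind M ih =>
    by_cases hF : (F x).Nonempty
    swap
    · have : x = 0 := by
        funext l
        rw [Pi.zero_apply, ← support_eq_empty, Finset.eq_empty_iff_forall_notMem]
        intro e he
        exact hF ⟨_, Finset.mem_biUnion.mpr ⟨l, Finset.mem_univ _,
          Finset.mem_image_of_mem _ he⟩⟩
      rw [this]
      exact W.zero_mem
    have hmax := (F x).max'_mem hF
    obtain ⟨j, -, hj⟩ := Finset.mem_biUnion.mp hmax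
    obtain ⟨e, he, heF⟩ := Finset.mem_image.mp hj
    set E := e + d j with hE
    have hEM : (F x).max = m.toSyn E := by rw [heF, Finset.coe_max']
    have hle : ∀ l, ∀ u ∈ (x l).support, m.toSyn (u + d l) ≤ m.toSyn E := by
      intro l u hu
      rw [heF]
      exact Finset.le_max' _ _ (Finset.mem_biUnion.mpr ⟨l, Finset.mem_univ _,
          Finset.mem_image_of_mem _ hu⟩)
    have hjE : d j ≤ E := le_add_self
    let a : κ → k := fun l => if d l ≤ E then (x l).coeff (E - d l) else 0
    have ha : ∑ l, a l = 0 := by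
      have := congrArg (coeff E) hx
      rw [coeff_sum, coeff_zero] at this
      rw [← this]
      exact Finset.sum_congr rfl fun l _ => ((hg l).coeff_mul (hle l)).symm
    have ha0 : ∀ l, ¬ d l ≤ E → a l = 0 := fun l h => if_neg h
    set y : κ → MvPolynomial σ k :=
      ∑ l, monomial (E - (d l ⊔ d j)) (a l) • sSyzygy d l j (q l j) with hy
    have hyW : y ∈ W := W.sum_mem fun l _ => W.smul_mem _ (Submodule.subset_span ⟨(l, j), rfl⟩)
    have hyg : ∑ l, y l * g l = 0 := by
      have : ∀ l, y l * g l = ∑ i, monomial (E - (d i ⊔ d j)) (a i) *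
          (sSyzygy d i j (q i j) l * g l) := by
        intro l
        simp only [hy, Finset.sum_apply, Pi.smul_apply, smul_eq_mul, Finset.sum_mul, mul_assoc]
      simp only [this]
      rw [Finset.sum_comm]
      simp only [← Finset.mul_sum, hS, mul_zero, Finset.sum_const_zero]
    have hmon : ∀ l i, i = l ∨ i = j → monomial (E - (d l ⊔ d j)) (a l) *
        monomial (d l ⊔ d j - d i) 1 = monomial (E - d i) (a l) := by
      intro l i hi
      by_cases hl : d l ≤ E
      · have h1 : d l ⊔ d j ≤ E := sup_le hl hjE
        have h2 : d i ≤ d l ⊔ d j := by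
          rcases hi with rfl | rfl
          exacts [le_sup_left, le_sup_right]
        rw [monomial_mul, mul_one, tsub_add_tsub_cancel h1 h2]
      · simp [ha0 l hl]
    have hyl : ∀ i, y i = monomial (E - d i) (a i) -
        ∑ l, monomial (E - (d l ⊔ d j)) (a l) * q l j i := by
      intro i
      have h1 : ∀ l, monomial (E - (d l ⊔ d j)) (a l) * sSyzygy d l j (q l j) i =
          (if i = l then monomial (E - d i) (a l) else 0) -
          (if i = j then monomial (E - d i) (a l) else 0) -
          monomial (E - (d l ⊔ d j)) (a l) * q l j i := by
        intro l
        simp only [sSyzygy, Pi.sub_apply, mul_sub, Pi.single_apply]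
        congr 2
        · split_ifs with h
          · subst h; exact hmon _ _ (Or.inl rfl)
          · rw [mul_zero]
        · split_ifs with h
          · subst h; exact hmon _ _ (Or.inr rfl)
          · rw [mul_zero]
      simp only [hy, Finset.sum_apply, Pi.smul_apply, smul_eq_mul, h1, Finset.sum_sub_distrib,
        Finset.sum_ite_eq, Finset.mem_univ, if_true]
      have h2 : ∑ l, (if i = j then monomial (E - d i) (a l) else 0) =
          (0 : MvPolynomial σ k) := by
        split_ifs
        · rw [← map_sum, ha, map_zero]
        · simp
      rw [h2, sub_zero]
    have hxy : x - y ∈ W := by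
      have hlt : ∀ i, (x - y) i ∈ m.shiftedBelow k (d i) (m.toSyn E) := by
        intro i
        rw [Pi.sub_apply, hyl, ← sub_add]
        refine Submodule.add_mem _ ?_ (Submodule.sum_mem _ fun l _ => ?_)
        · refine mem_shiftedBelow.mpr fun u hu => ?_
          have hu0 := mem_support_iff.mp hu
          rw [coeff_sub, coeff_monomial] at hu0
          have hux : u ∈ (x i).support ∨ u = E - d i ∧ d i ≤ E := by
            by_contra! hcon
            obtain ⟨hc1, hc2⟩ := hcon
            rw [notMem_support_iff.mp hc1] at hu0
            by_cases hu1 : E - d i = u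
            · rw [if_pos hu1, ha0 i (hc2 hu1.symm)] at hu0
              simp at hu0
            · simp [hu1] at hu0
          have hule : m.toSyn (u + d i) ≤ m.toSyn E := by
            rcases hux with h | ⟨rfl, h⟩
            · exact hle i u h
            · rw [tsub_add_cancel_of_le h]
          refine lt_of_le_of_ne hule fun heq => hu0 ?_
          have hEu : u + d i = E := m.toSyn.injective heq
          have hu2 : E - d i = u := by rw [← hEu, add_tsub_cancel_right]
          have hdE : d i ≤ E := by rw [← hEu]; exact le_add_self
          rw [if_pos hu2]
          simp only [a, if_pos hdE, hu2, sub_self]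
        · by_cases hl : d l ≤ E
          · exact monomial_mul_mem_shiftedBelow _ (hq l j i) (sup_le hl hjE)
          · rw [ha0 l hl, map_zero, zero_mul]
            exact Submodule.zero_mem _
      refine ih _ ?_ (x - y) ?_ rfl
      · rw [← hM, hEM, Finset.max_eq_sup_withBot, Finset.sup_lt_iff (WithBot.bot_lt_coe _)]
        intro b hb
        obtain ⟨l, -, hl⟩ := Finset.mem_biUnion.mp hb
        obtain ⟨u, hu, rfl⟩ := Finset.mem_image.mp hl
        exact WithBot.coe_lt_coe.mpr (mem_shiftedBelow.mp (hlt l) u hu)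
      · simp only [Pi.sub_apply, sub_mul, Finset.sum_sub_distrib, hx, hyg, sub_zero]
    simpa using W.add_mem hxy hyW

end Syzygies
end MonomialOrder

namespace MonomialOrder

open MvPolynomial

section StandardBasis

variable {σ k κ : Type*} [CommRing k] {m : MonomialOrder σ} {s : Set σ}

theorem support_subset_of_mem_supported {p : MvPolynomial σ k} (hp : p ∈ supported k s)
    {e : σ →₀ ℕ} (he : e ∈ p.support) : (e.support : Set σ) ⊆ s := fun i hi =>
  mem_supported.mp hp (mem_vars_iff_mem_support i |>.mpr ⟨e, he, hi⟩)

theorem monomial_mem_supported {e : σ →₀ ℕ} (he : (e.support : Set σ) ⊆ s) (c : k) :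
    monomial e c ∈ supported k s := by
  rw [mem_supported]
  by_cases hc : c = 0
  · simp [hc]
  · rwa [vars_monomial hc]

theorem exists_standard_representation [Fintype κ] {I : Ideal (MvPolynomial σ k)}
    {g : κ → MvPolynomial σ k} {d : κ → σ →₀ ℕ} (hg : ∀ j, m.HasMonicLead (g j) (d j))
    (hgI : ∀ j, g j ∈ I) (hgs : ∀ j, g j ∈ supported k s)
    (hlead : ∀ p ∈ I, p ∈ supported k s → p ≠ 0 → ∃ j, d j ≤ m.degree p)
    (N : m.syn) (p : MvPolynomial σ k) (hpI : p ∈ I) (hps : p ∈ supported k s)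
    (hp : p ∈ m.shiftedBelow k 0 N) :
    ∃ q : κ → MvPolynomial σ k, p = ∑ l, q l * g l ∧ ∀ l, q l ∈ m.shiftedBelow k (d l) N := by
  classical
  induction N using WellFoundedLT.induction generalizing p with
  | ind N ih =>
  by_cases hp0 : p = 0
  · exact ⟨0, by simp [hp0], fun l => Submodule.zero_mem _⟩
  obtain ⟨j, hj⟩ := hlead p hpI hps hp0
  set E := m.degree p with hE
  have hEp : E ∈ p.support := m.degree_mem_support hp0
  have hEN : m.toSyn E < N := by simpa using mem_shiftedBelow.mp hp E hEp
  have hmons : monomial (E - d j) (p.coeff E) ∈ supported k s :=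
    monomial_mem_supported (fun i hi => support_subset_of_mem_supported hps hEp
      (Finsupp.support_mono tsub_le_self hi)) _
  obtain ⟨q, hq, hqN⟩ := ih _ hEN (p - monomial (E - d j) (p.coeff E) * g j)
    (I.sub_mem hpI (I.mul_mem_left _ (hgI j)))
    (sub_mem hps (mul_mem hmons (hgs j)))
    ((hg j).sub_monomial_mul_mem le_rfl hj)
  refine ⟨q + Pi.single j (monomial (E - d j) (p.coeff E)), ?_, fun l => ?_⟩
  · simp only [Pi.add_apply, add_mul, Finset.sum_add_distrib, ← hq, Pi.single_apply, ite_mul,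
      zero_mul, Finset.sum_ite_eq', Finset.mem_univ, if_true, sub_add_cancel]
  · refine Submodule.add_mem _ (shiftedBelow_mono hEN.le (hqN l)) ?_
    rw [Pi.single_apply]
    split_ifs with h
    · subst h
      refine mem_shiftedBelow.mpr fun u hu => ?_
      have hu' : u = E - d l := by simpa using support_monomial_subset hu
      rwa [hu', tsub_add_cancel_of_le hj]
    · exact Submodule.zero_mem _

theorem exists_finite_lower_bounds {s : Set σ} (hs : s.Finite) {D : Set (σ →₀ ℕ)}
    (hD : ∀ d ∈ D, (d.support : Set σ) ⊆ s) :
    ∃ T ⊆ D, T.Finite ∧ ∀ d ∈ D, ∃ t ∈ T, t ≤ d := by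
  classical
  have : Finite s := hs
  have hpwo : D.IsPWO := by
    have h1 : (Set.univ : Set (s →₀ ℕ)).IsPWO := Set.isPWO_of_wellQuasiOrderedLE _
    have hmono : Monotone (Finsupp.extendDomain : (s →₀ ℕ) → (σ →₀ ℕ)) := by
      intro a b hab i
      by_cases hi : i ∈ s
      · simpa [Finsupp.extendDomain_apply, hi] using hab ⟨i, hi⟩
      · simp [Finsupp.extendDomain_apply, hi]
    refine (h1.image_of_monotone hmono).mono fun d hd => ⟨d.subtypeDomain (· ∈ s), trivial, ?_⟩
    exact Finsupp.extendDomain_subtypeDomain d fun i hi => hD d hd hi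
  refine ⟨{d | Minimal (· ∈ D) d}, fun d hd => hd.prop, ?_, fun d hd => ?_⟩
  · exact (setOfPred_minimal_antichain (· ∈ D)).finite_of_partiallyWellOrderedOn
      (hpwo.mono fun d hd => hd.prop)
  · obtain ⟨b, hb, hbm⟩ := hpwo.exists_le_minimal hd
    exact ⟨b, hbm, hb⟩

end StandardBasis

/-- Every finitely generated ideal of a polynomial ring over a field (given as a commutative ring
with invertible nonzero elements) has a finite generating family of monic polynomials whose S-polynomials have standard representations. -/
theorem exists_standard_basis {σ k : Type} [CommRing k] [Nonempty σ]
    (hk : ∀ a : k, a ≠ 0 → ∃ b, b * a = 1) (m : MonomialOrder σ) {l : ℕ}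
    (f : Fin l → MvPolynomial σ k) :
    ∃ (κ : Type) (_ : Fintype κ) (_ : DecidableEq κ) (g : κ → MvPolynomial σ k)
      (d : κ → σ →₀ ℕ) (q : κ → κ → κ → MvPolynomial σ k),
      (∀ j, m.HasMonicLead (g j) (d j)) ∧
      (∀ i j t, q i j t ∈ m.shiftedBelow k (d t) (m.toSyn (d i ⊔ d j))) ∧
      (∀ i j, ∑ t, sSyzygy d i j (q i j) t * g t = 0) ∧
      (∀ j, g j ∈ Ideal.span (Set.range f)) ∧
      (∀ i, ∃ a : κ → MvPolynomial σ k, f i = ∑ j, a j * g j) := by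
  classical
  set I := Ideal.span (Set.range f)
  let s : Set σ := ⋃ i, ((f i).vars : Set σ)
  have hs : s.Finite := Set.finite_iUnion fun i => (f i).vars.finite_toSet
  have hfs : ∀ i, f i ∈ supported k s := fun i =>
    mem_supported.mpr (Set.subset_iUnion (fun i => ((f i).vars : Set σ)) i)
  obtain ⟨T, hTD, hTfin, hT⟩ := exists_finite_lower_bounds hs
    (D := {d | ∃ p ∈ I, p ∈ supported k s ∧ p ≠ 0 ∧ m.degree p = d}) (by
      rintro _ ⟨p, -, hps, hp0, rfl⟩
      exact support_subset_of_mem_supported hps (m.degree_mem_support hp0))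
  have : Fintype T := hTfin.fintype
  let d : T → σ →₀ ℕ := Subtype.val
  have hd : ∀ t : T, ∃ p ∈ I, p ∈ supported k s ∧ p ≠ 0 ∧ m.degree p = d t := fun t => hTD t.2
  choose p hpI hps hp0 hpd using hd
  choose u hu using fun t => hk _ (m.leadingCoeff_ne_zero_iff.mpr (hp0 t))
  let g : T → MvPolynomial σ k := fun t => C (u t) * p t
  have hgI : ∀ t, g t ∈ I := fun t => I.mul_mem_left _ (hpI t)
  have hgs : ∀ t, g t ∈ supported k s := fun t =>
    mul_mem ((supported k s).algebraMap_mem _) (hps t)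
  have hg : ∀ t, m.HasMonicLead (g t) (d t) := by
    intro t
    constructor
    · intro e he
      rw [← hpd t]
      refine m.le_degree (mem_support_iff.mpr fun h => mem_support_iff.mp he ?_)
      rw [coeff_C_mul, h, mul_zero]
    · rw [coeff_C_mul, ← hpd t]
      exact hu t
  have hTs : ∀ t : T, ((d t).support : Set σ) ⊆ s := fun t =>
    hpd t ▸ support_subset_of_mem_supported (hps t) (m.degree_mem_support (hp0 t))
  have hlead : ∀ p ∈ I, p ∈ supported k s → p ≠ 0 → ∃ t : T, d t ≤ m.degree p := by
    intro p hpI hps hp0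
    obtain ⟨t, ht, hle⟩ := hT _ ⟨p, hpI, hps, hp0, rfl⟩
    exact ⟨⟨t, ht⟩, hle⟩
  have hrep := fun N p => exists_standard_representation hg hgI hgs hlead N p
  have hmon : ∀ i j t : T, monomial (d i ⊔ d j - d t) (1 : k) ∈ supported k s := by
    intro i j t
    refine monomial_mem_supported (fun x hx => ?_) _
    have := Finsupp.support_mono tsub_le_self hx
    rw [Finsupp.support_sup, Finset.mem_union] at this
    exact this.elim (fun h => hTs i h) (fun h => hTs j h)
  have hS : ∀ i j : T, ∃ q : T → MvPolynomial σ k,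
      monomial (d i ⊔ d j - d i) 1 * g i - monomial (d i ⊔ d j - d j) 1 * g j =
        ∑ t, q t * g t ∧ ∀ t : T, q t ∈ m.shiftedBelow k (d t) (m.toSyn (d i ⊔ d j)) := by
    intro i j
    have hsub : ∀ i' : T, d i' ≤ d i ⊔ d j →
        monomial (d i ⊔ d j) (1 : k) - monomial (d i ⊔ d j - d i') 1 * g i' ∈
          m.shiftedBelow k 0 (m.toSyn (d i ⊔ d j)) := by
      intro i' hi'
      simpa using (hg i').sub_monomial_mul_mem (p := monomial (d i ⊔ d j) (1 : k))
        (m.degree_monomial_le _) hi'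
    refine hrep _ _ (I.sub_mem (I.mul_mem_left _ (hgI i)) (I.mul_mem_left _ (hgI j)))
      (sub_mem (mul_mem (hmon i j i) (hgs i)) (mul_mem (hmon i j j) (hgs j))) ?_
    have := Submodule.sub_mem _ (hsub j le_sup_right) (hsub i le_sup_left)
    rwa [sub_sub_sub_cancel_left] at this
  choose q hqS hq using hS
  refine ⟨T, inferInstance, inferInstance, g, d, q, hg, hq, fun i j => ?_, hgI, fun i => ?_⟩
  · simp only [sSyzygy, Pi.sub_apply, sub_mul, Finset.sum_sub_distrib, ← hqS, Pi.single_apply,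
      ite_mul, zero_mul, Finset.sum_ite_eq', Finset.mem_univ, if_true, sub_self]
  · obtain ⟨x⟩ := ‹Nonempty σ›
    have hlt : f i ∈ m.shiftedBelow k 0 (m.toSyn (m.degree (f i) + Finsupp.single x 1)) := by
      refine mem_shiftedBelow.mpr fun e he => ?_
      rw [add_zero, map_add]
      refine (m.le_degree he).trans_lt (lt_add_of_pos_right _ ?_)
      rw [toSyn_lt_iff_ne_zero, Ne, m.toSyn_eq_zero_iff]
      simp
    obtain ⟨a, ha, -⟩ := hrep _ _ (Ideal.subset_span ⟨i, rfl⟩) (hfs i) hlt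
    exact ⟨a, ha⟩

end MonomialOrder

/-- A relation on `f` becomes trivial as soon as the induced relation on another generating family
of the same ideal is a combination of relations defined over the base ring. -/
theorem Module.isTrivialRelation_of_generators {A M α κ ν : Type*} [CommRing A] [AddCommGroup M]
    [Module A M] [Fintype α] [DecidableEq α] [Fintype κ] [Fintype ν] {f : α → A} {g : κ → A}
    {a : α → κ → A} {b : κ → α → A} (ha : ∀ i, f i = ∑ j, a i j * g j)
    (hb : ∀ j, g j = ∑ i, b j i * f i) {s : ν → κ → A} (hs : ∀ n, ∑ j, s n j * g j = 0)
    {x : α → M} {c : ν → M} (hc : ∀ j, ∑ i, a i j • x i = ∑ n, s n j • c n) :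
    Module.IsTrivialRelation f x := by
  rw [Module.isTrivialRelation_iff_vanishesTrivially]
  refine TensorProduct.VanishesTrivially.of_fintype (κ := ν ⊕ α)
    (fun i => Sum.elim (fun n => ∑ j, s n j * b j i)
      (fun i' => (if i = i' then 1 else 0) - ∑ j, a i' j * b j i)) (Sum.elim c x) ?_ ?_
  · intro i
    have h1 : ∑ n, (∑ j, s n j * b j i) • c n = ∑ i', (∑ j, a i' j * b j i) • x i' := by
      simp only [Finset.sum_smul]
      rw [Finset.sum_comm, Finset.sum_comm (s := (Finset.univ : Finset α))]
      refine Finset.sum_congr rfl fun j _ => ?_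
      simp only [mul_comm _ (b j i), mul_smul, ← Finset.smul_sum, hc]
    simp only [Fintype.sum_sum_type, Sum.elim_inl, Sum.elim_inr, h1, sub_smul,
      Finset.sum_sub_distrib, ite_smul, one_smul, zero_smul, Finset.sum_ite_eq, Finset.mem_univ,
      if_true, add_sub_cancel]
  · have h2 : ∀ v : κ → A, ∑ i, (∑ j, v j * b j i) * f i = ∑ j, v j * g j := by
      intro v
      simp only [Finset.sum_mul, hb, Finset.mul_sum, mul_assoc]
      exact Finset.sum_comm
    rintro (n | i')
    · simp only [Sum.elim_inl, smul_eq_mul, h2, hs]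
    · simp only [Sum.elim_inr, smul_eq_mul, sub_mul, Finset.sum_sub_distrib, h2, ← ha, ite_mul,
        one_mul, zero_mul, Finset.sum_ite_eq', Finset.mem_univ, if_true, sub_self]

section InternalPolynomials

open MvPolynomial

/-- The quotient map onto the ultraproduct as a ring homomorphism. -/
def UProd.mkHom {ι : Type} (𝒰 : Ultrafilter ι) (R : ι → Type) [∀ i, CommRing (R i)] :
    (∀ i, R i) →+* UProd 𝒰 R where
  toFun := UProd.mk 𝒰
  map_one' := rfl
  map_zero' := rfl
  map_mul' _ _ := rfl
  map_add' _ _ := rfl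

theorem UProd.mkHom_surjective {ι : Type} (𝒰 : Ultrafilter ι) (R : ι → Type)
    [∀ i, CommRing (R i)] : Function.Surjective (UProd.mkHom 𝒰 R) :=
  Quotient.mk_surjective

theorem UProd.mkHom_eq_iff {ι : Type} {𝒰 : Ultrafilter ι} {R : ι → Type}
    [∀ i, CommRing (R i)] {a b : ∀ i, R i} :
    UProd.mkHom 𝒰 R a = UProd.mkHom 𝒰 R b ↔ ∀ᶠ i in (𝒰 : Filter ι), a i = b i :=
  Quotient.eq

variable {ι : Type} {𝒰 : Ultrafilter ι} {K : ι → Type} [∀ i, Field (K i)]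

/-- A family of polynomials over the coordinate fields representing a polynomial over the
ultraproduct. -/
noncomputable def coordPoly (p : MvPolynomial ℕ (UProd 𝒰 K)) (r : ι) : MvPolynomial ℕ (K r) :=
  ∑ e ∈ p.support, monomial e ((p.coeff e).out r)

theorem support_coordPoly_subset (p : MvPolynomial ℕ (UProd 𝒰 K)) (r : ι) :
    (coordPoly p r).support ⊆ p.support := by
  classical
  intro e he
  by_contra hne
  refine mem_support_iff.mp he ?_
  simp only [coordPoly, coeff_sum, coeff_monomial]
  exact Finset.sum_eq_zero fun u hu => if_neg fun h => hne (by rwa [← h])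

theorem eventually_coeff_coordPoly {p : MvPolynomial ℕ (UProd 𝒰 K)} {e : ℕ →₀ ℕ}
    (h : p.coeff e = 1) : ∀ᶠ r in (𝒰 : Filter ι), (coordPoly p r).coeff e = 1 := by
  classical
  have h1 : UProd.mkHom 𝒰 K (p.coeff e).out = UProd.mkHom 𝒰 K 1 := by
    rw [map_one, ← h]
    exact Quotient.out_eq _
  have he : e ∈ p.support := by
    rw [mem_support_iff, h, ← map_one (UProd.mkHom 𝒰 K), ← map_zero (UProd.mkHom 𝒰 K)]
    intro h0
    obtain ⟨r, hr⟩ := (UProd.mkHom_eq_iff.mp h0).exists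
    exact one_ne_zero hr
  filter_upwards [UProd.mkHom_eq_iff.mp h1] with r hr
  simp only [coordPoly, coeff_sum, coeff_monomial, Finset.sum_ite_eq', if_pos he]
  exact hr

theorem upPolyEmb_monomial (e : ℕ →₀ ℕ) (a : ∀ i, K i) :
    upPolyEmb 𝒰 K (monomial e (UProd.mkHom 𝒰 K a)) =
      UProd.mkHom 𝒰 (fun i => MvPolynomial ℕ (K i)) (fun r => monomial e (a r)) := by
  have h1 : (fun r => monomial e (a r) : ∀ r, MvPolynomial ℕ (K r)) =
      (fun r => C (a r)) * e.prod fun j n => (fun _ => X j) ^ n := by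
    funext r
    rw [monomial_eq]
    simp only [Pi.mul_apply, Finsupp.prod, Finset.prod_apply, Pi.pow_apply]
  rw [h1, map_mul, map_finsuppProd]
  simp only [map_pow]
  exact eval₂_monomial _ _

theorem upPolyEmb_eq_mkHom (p : MvPolynomial ℕ (UProd 𝒰 K)) :
    upPolyEmb 𝒰 K p = UProd.mkHom 𝒰 (fun i => MvPolynomial ℕ (K i)) (coordPoly p) := by
  have hsum : coordPoly p = ∑ e ∈ p.support, fun r => monomial e ((p.coeff e).out r) := by
    funext r
    simp [coordPoly]
  conv_lhs => rw [p.as_sum]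
  rw [hsum, map_sum, map_sum]
  refine Finset.sum_congr rfl fun e _ => ?_
  rw [← upPolyEmb_monomial]
  congr 2
  exact (Quotient.out_eq _).symm

theorem exists_combination_of_sSyzygy {κ : Type} [Fintype κ] [DecidableEq κ]
    {m : MonomialOrder ℕ} {g : κ → MvPolynomial ℕ (UProd 𝒰 K)} {d : κ → ℕ →₀ ℕ}
    {q : κ → κ → κ → MvPolynomial ℕ (UProd 𝒰 K)} (hg : ∀ j, m.HasMonicLead (g j) (d j))
    (hq : ∀ i j l, q i j l ∈ m.shiftedBelow _ (d l) (m.toSyn (d i ⊔ d j)))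
    (hS : ∀ i j, ∑ l, MonomialOrder.sSyzygy d i j (q i j) l * g l = 0)
    {y : κ → UProd 𝒰 (fun i => MvPolynomial ℕ (K i))}
    (hy : ∑ l, upPolyEmb 𝒰 K (g l) * y l = 0) :
    ∃ c : κ × κ → UProd 𝒰 (fun i => MvPolynomial ℕ (K i)), ∀ l, y l =
      ∑ ij, upPolyEmb 𝒰 K (MonomialOrder.sSyzygy d ij.1 ij.2 (q ij.1 ij.2) l) * c ij := by
  classical
  let π := UProd.mkHom 𝒰 (fun i => MvPolynomial ℕ (K i))
  choose Y hY using fun l => UProd.mkHom_surjective 𝒰 (fun i => MvPolynomial ℕ (K i)) (y l)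
  let S : κ → κ → κ → ∀ r, MvPolynomial ℕ (K r) := fun i j l r =>
    MonomialOrder.sSyzygy d i j (fun t => coordPoly (q i j t) r) l
  have hmon : ∀ e : ℕ →₀ ℕ, upPolyEmb 𝒰 K (monomial e 1) = π fun r => monomial e 1 := by
    intro e
    rw [← map_one (UProd.mkHom 𝒰 K)]
    exact upPolyEmb_monomial e 1
  have hSπ : ∀ i j l, upPolyEmb 𝒰 K (MonomialOrder.sSyzygy d i j (q i j) l) = π (S i j l) := by
    intro i j l
    have h1 : S i j l = (if l = i then (fun r => monomial (d i ⊔ d j - d i) 1 : ∀ r, MvPolynomial ℕ (K r)) else 0) -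
        (if l = j then (fun r => monomial (d i ⊔ d j - d j) 1 : ∀ r, MvPolynomial ℕ (K r)) else 0) -
        coordPoly (q i j l) := by
      funext r
      simp only [S, MonomialOrder.sSyzygy, Pi.sub_apply, Pi.single_apply]
      congr 2 <;> split_ifs <;> rfl
    rw [h1, map_sub, map_sub]
    simp only [MonomialOrder.sSyzygy, Pi.sub_apply, Pi.single_apply, map_sub,
      apply_ite (upPolyEmb 𝒰 K), apply_ite π, map_zero, hmon]
    rw [upPolyEmb_eq_mkHom (q i j l)]
  have hy' : ∀ᶠ r in (𝒰 : Filter ι), ∑ l, Y l r * coordPoly (g l) r = 0 := by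
    have : π (∑ l, Y l * coordPoly (g l)) = π 0 := by
      rw [map_sum, map_zero, ← hy]
      refine Finset.sum_congr rfl fun l _ => ?_
      rw [map_mul, upPolyEmb_eq_mkHom, mul_comm, ← hY]
    filter_upwards [UProd.mkHom_eq_iff.mp this] with r hr
    simpa using hr
  have hS' : ∀ᶠ r in (𝒰 : Filter ι), ∀ i j, ∑ l, S i j l r * coordPoly (g l) r = 0 := by
    simp only [eventually_all]
    intro i j
    have : π (∑ l, S i j l * coordPoly (g l)) = π 0 := by
      rw [map_sum, map_zero, ← map_zero (upPolyEmb 𝒰 K), ← hS i j, map_sum]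
      refine Finset.sum_congr rfl fun l _ => ?_
      rw [map_mul, map_mul, upPolyEmb_eq_mkHom (g l), hSπ]
    filter_upwards [UProd.mkHom_eq_iff.mp this] with r hr
    simpa using hr
  have hg' : ∀ᶠ r in (𝒰 : Filter ι), ∀ j, m.HasMonicLead (coordPoly (g j) r) (d j) := by
    rw [eventually_all]
    intro j
    filter_upwards [eventually_coeff_coordPoly (hg j).2] with r hr
    exact ⟨fun e he => (hg j).1 e (support_coordPoly_subset _ r he), hr⟩
  have hspan : ∀ᶠ r in (𝒰 : Filter ι), ∃ c : κ × κ → MvPolynomial ℕ (K r),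
      ∑ ij, c ij • (fun l => S ij.1 ij.2 l r) = fun l => Y l r := by
    filter_upwards [hy', hS', hg'] with r hyr hSr hgr
    exact (Submodule.mem_span_range_iff_exists_fun _).mp
      (MonomialOrder.mem_span_sSyzygy hgr (q := fun i j t => coordPoly (q i j t) r)
        (fun i j l => MonomialOrder.mem_shiftedBelow.mpr fun e he =>
          hq i j l (support_coordPoly_subset _ r he)) hSr (fun l => Y l r) hyr)
  have hex : ∀ r, ∃ c : κ × κ → MvPolynomial ℕ (K r),
      (∃ c : κ × κ → MvPolynomial ℕ (K r),
        ∑ ij, c ij • (fun l => S ij.1 ij.2 l r) = fun l => Y l r) →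
      ∑ ij, c ij • (fun l => S ij.1 ij.2 l r) = fun l => Y l r := by
    intro r
    by_cases h : ∃ c : κ × κ → MvPolynomial ℕ (K r),
        ∑ ij, c ij • (fun l => S ij.1 ij.2 l r) = fun l => Y l r
    · exact ⟨h.choose, fun _ => h.choose_spec⟩
    · exact ⟨0, fun h' => absurd h' h⟩
  choose c hc using hex
  refine ⟨fun ij => π fun r => c r ij, fun l => ?_⟩
  simp only [hSπ]
  have hsum : ∑ ij : κ × κ, π (S ij.1 ij.2 l) * π (fun r => c r ij) =
      π (∑ ij : κ × κ, S ij.1 ij.2 l * fun r => c r ij) := by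
    rw [map_sum]
    exact Finset.sum_congr rfl fun _ _ => (map_mul _ _ _).symm
  rw [hsum, ← hY]
  refine UProd.mkHom_eq_iff.mpr ?_
  filter_upwards [hspan] with r hr
  have := congrFun (hc r hr) l
  rw [← this]
  simp [mul_comm]

end InternalPolynomials

/-- Let `(K i)` be a family of fields indexed by `ι` with nonprincipal ultrafilter `𝒰`,
`K = ∏_𝒰 K i`, and consider the natural embedding of the polynomial ring `K[Z_j : j < ω]`
into the internal polynomial ring `∏_𝒰 (K i)[Z_j : j < ω]`.  Then the internal polynomial
ring is a flat module over `K[Z_j : j < ω]`. -/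
theorem internal_poly_flat {ι : Type} (𝒰 : Ultrafilter ι)
    (hnp : ∀ i : ι, {i} ∉ (𝒰 : Filter ι))
    (K : ι → Type) [∀ i, Field (K i)] :
    letI := (upPolyEmb 𝒰 K).toAlgebra
    Module.Flat (MvPolynomial ℕ (UProd 𝒰 K)) (UProd 𝒰 (fun i => MvPolynomial ℕ (K i))) := by

  let _ := (upPolyEmb 𝒰 K).toAlgebra
  have hsmul : ∀ (p : MvPolynomial ℕ (UProd 𝒰 K)) (x : UProd 𝒰 (fun i => MvPolynomial ℕ (K i))),
      p • x = upPolyEmb 𝒰 K p * x := fun _ _ => rfl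
  refine Module.Flat.of_forall_isTrivialRelation fun {l f x} hfx => ?_
  have hk : ∀ a : UProd 𝒰 K, a ≠ 0 → ∃ b, b * a = 1 := by
    intro a ha
    obtain ⟨a, rfl⟩ := UProd.mkHom_surjective 𝒰 K a
    refine ⟨UProd.mkHom 𝒰 K fun r => (a r)⁻¹, ?_⟩
    have ha' : ∀ᶠ r in (𝒰 : Filter ι), a r ≠ 0 := by
      rw [Ultrafilter.eventually_not]
      exact fun h => ha ((UProd.mkHom_eq_iff (b := 0)).mpr h)
    rw [← map_mul, ← map_one (UProd.mkHom 𝒰 K)]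
    refine UProd.mkHom_eq_iff.mpr ?_
    filter_upwards [ha'] with r hr
    exact inv_mul_cancel₀ hr
  let m : MonomialOrder ℕ := (MonomialOrder.lex : MonomialOrder ℕᵒᵈ)
  obtain ⟨κ, _, _, g, d, q, hg, hq, hS, hgf, hfg⟩ := MonomialOrder.exists_standard_basis hk m f
  choose a ha using hfg
  have hgf' : ∀ j, ∃ b : Fin l → MvPolynomial ℕ (UProd 𝒰 K), ∑ i, b i * f i = g j := fun j =>
    (Submodule.mem_span_range_iff_exists_fun _).mp (hgf j)
  choose b hb using hgf'
  have hy : ∑ j, upPolyEmb 𝒰 K (g j) * ∑ i, a i j • x i = 0 := by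
    rw [← hfx]
    simp only [hsmul, ha, map_sum, Finset.mul_sum, Finset.sum_mul]
    rw [Finset.sum_comm]
    refine Finset.sum_congr rfl fun i _ => Finset.sum_congr rfl fun j _ => ?_
    rw [RingHom.map_mul]
    ring
  obtain ⟨c, hc⟩ := exists_combination_of_sSyzygy hg hq hS hy
  exact Module.isTrivialRelation_of_generators ha (fun j => (hb j).symm)
    (fun ij : κ × κ => hS ij.1 ij.2) hc
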